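/- arXiv:math/9701208 — 6 statements merged into one kernel-verified Lean document; each statement's English description precedes it below -/
import Mathlib

section
/- Let G be a finite abelian group of order g, let V be a finitely generated ℚ[G]-module (equivalently, a finite-dimensional ℚ-vector space with a ℚ-linear G-action), and let f be a ℚ[G]-linear endomorphism of V. Then the trace of f computed over the group ring ℚ[G] satisfies Tr_{ℚ[G]}(f; V) = (1/g)·∑_{σ∈G} Tr_ℚ(σ⁻¹∘f; V)·σ, an identity in ℚ[G]. -/
/-- The `ℚ`-linear endomorphism of `V` given by the action of the group element `σ`
through the group ring `ℚ[G]`. -/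
noncomputable def groupEltAction {G : Type*} [CommGroup G]
    (V : Type*) [AddCommGroup V] [Module ℚ V] [Module (MonoidAlgebra ℚ G) V]
    [IsScalarTower ℚ (MonoidAlgebra ℚ G) V] (σ : G) : V →ₗ[ℚ] V where
  toFun v := MonoidAlgebra.of ℚ G σ • v
  map_add' v w := smul_add _ v w
  map_smul' c v := by
    simp only [RingHom.id_apply]
    rw [← algebraMap_smul (MonoidAlgebra ℚ G) c v,
      ← algebraMap_smul (MonoidAlgebra ℚ G) c (MonoidAlgebra.of ℚ G σ • v),
      smul_smul, smul_smul, mul_comm]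

/-- Transitivity of the trace of a linear map, given bases. -/
theorem LinearMap.trace_restrictScalars_of_basis {R S M ι κ : Type*} [CommRing R] [CommRing S]
    [Algebra R S] [AddCommGroup M] [Module R M] [Module S M] [IsScalarTower R S M]
    [Fintype ι] [Fintype κ] (b : Module.Basis ι R S) (c : Module.Basis κ S M) (f : M →ₗ[S] M) :
    LinearMap.trace R M (f.restrictScalars R) = Algebra.trace R S (LinearMap.trace S M f) := by
  classical
  rw [LinearMap.trace_eq_matrix_trace R (b.smulTower c),
    LinearMap.trace_eq_matrix_trace S c, Matrix.trace, Matrix.trace, map_sum,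
    Fintype.sum_prod_type_right]
  refine Finset.sum_congr rfl fun j _ => ?_
  rw [Algebra.trace_eq_matrix_trace b, Matrix.trace]
  refine Finset.sum_congr rfl fun i _ => ?_
  simp [LinearMap.toMatrix_apply, Algebra.leftMulMatrix_eq_repr_mul, mul_comm]

/-- The regular trace of an element of a group algebra is `|G|` times its coefficient at `1`. -/
theorem MonoidAlgebra.trace_eq_card_mul_coeff_one {R G : Type*} [CommRing R] [CommGroup G]
    [Fintype G] (x : MonoidAlgebra R G) :
    Algebra.trace R (MonoidAlgebra R G) x = Fintype.card G * x.coeff 1 := by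
  classical
  rw [Algebra.trace_eq_matrix_trace (MonoidAlgebra.basis G R), Matrix.trace]
  have h (y : MonoidAlgebra R G) (g : G) : (MonoidAlgebra.basis G R).repr y g = y.coeff g := rfl
  simp [Algebra.leftMulMatrix_eq_repr_mul, h]

/-- **Lemma A.2 (1).** Let `G` be a finite abelian group of order `g`, `V` a finitely
generated `ℚ[G]`-module and `f` a `ℚ[G]`-linear endomorphism of `V`.  The trace of
`f` over the group ring `ℚ[G]` — computed by embedding `V` as a direct summand of a
free module `ℚ[G]ⁿ` via `e : V ⊕ W ≅ ℚ[G]ⁿ` and taking the trace of `f ⊕ 0` — equals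
`(1/g)·∑_{σ ∈ G} Tr_ℚ(σ⁻¹∘f; V)·σ` in `ℚ[G]`. -/
theorem trace_groupRing_eq
    {G : Type*} [CommGroup G] [Fintype G]
    (V W : Type*) [AddCommGroup V] [Module ℚ V] [Module (MonoidAlgebra ℚ G) V]
    [IsScalarTower ℚ (MonoidAlgebra ℚ G) V]
    [AddCommGroup W] [Module (MonoidAlgebra ℚ G) W]
    (f : V →ₗ[MonoidAlgebra ℚ G] V)
    (n : ℕ) (e : (V × W) ≃ₗ[MonoidAlgebra ℚ G] (Fin n → MonoidAlgebra ℚ G)) :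
    LinearMap.trace (MonoidAlgebra ℚ G) (Fin n → MonoidAlgebra ℚ G)
        (e.toLinearMap ∘ₗ f.prodMap (0 : W →ₗ[MonoidAlgebra ℚ G] W) ∘ₗ
          e.symm.toLinearMap) =
      ∑ σ : G, ((Fintype.card G : ℚ)⁻¹ *
          LinearMap.trace ℚ V ((groupEltAction V σ⁻¹) ∘ₗ (f.restrictScalars ℚ))) •
        MonoidAlgebra.of ℚ G σ := by
  let A := MonoidAlgebra ℚ G
  let i : V →ₗ[A] (Fin n → A) := e.toLinearMap ∘ₗ LinearMap.inl A V W
  let p : (Fin n → A) →ₗ[A] V := LinearMap.fst A V W ∘ₗ e.symm.toLinearMap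
  have hpi : ∀ v, p (i v) = v := fun v => by simp [i, p]
  have hF : e.toLinearMap ∘ₗ f.prodMap (0 : W →ₗ[A] W) ∘ₗ e.symm.toLinearMap = i ∘ₗ f ∘ₗ p := by
    refine LinearMap.ext fun v => ?_
    simp [i, p]
  have : Module.Finite ℚ A := Module.Finite.of_basis (MonoidAlgebra.basis G ℚ)
  have : Module.Finite ℚ (Fin n → A) := Module.Finite.pi
  have : Module.Finite ℚ V := Module.Finite.of_surjective (p.restrictScalars ℚ)
    fun v => ⟨i v, hpi v⟩
  have hV (σ : G) : LinearMap.trace ℚ V (groupEltAction V σ ∘ₗ f.restrictScalars ℚ) =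
      Fintype.card G * (LinearMap.trace A (Fin n → A) (i ∘ₗ f ∘ₗ p)).coeff σ⁻¹ := by
    have hcoeff (x : A) : Fintype.card G * x.coeff σ⁻¹ =
        Algebra.trace ℚ A (MonoidAlgebra.of ℚ G σ * x) := by
      simp only [A, MonoidAlgebra.trace_eq_card_mul_coeff_one, MonoidAlgebra.of_apply,
        MonoidAlgebra.coeff_single_mul_apply, one_mul, mul_one]
    rw [hcoeff, ← smul_eq_mul, ← map_smul, ← LinearMap.trace_restrictScalars_of_basis
      (MonoidAlgebra.basis G ℚ) (Pi.basisFun A (Fin n))]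
    have h := LinearMap.trace_comp_comm' (i.restrictScalars ℚ)
      ((groupEltAction V σ ∘ₗ f.restrictScalars ℚ) ∘ₗ p.restrictScalars ℚ)
    convert! h using 2
    · ext v
      simp [hpi]
    · refine LinearMap.ext fun v => ?_
      simp [groupEltAction]
  rw [hF]
  ext τ
  simp [hV, A, MonoidAlgebra.coeff_sum]
end

section
/- Let G be a finite abelian group, let ℓ be a prime number, let M be a ℤ[G]-module, and let f be a G-equivariant endomorphism of M. Assume: (i) for every n ≥ 1 the multiplication-by-ℓ map M[ℓ^{n+1}] → M[ℓⁿ] is surjective; (ii) the ℓ-adic Tate module T_ℓ(M) is a free ℤ_ℓ-module of finite rank; (iii) the fixed subgroup M^f = {m ∈ M : f(m) = m} is finite. Let T_ℓ(f) denote the endomorphism of T_ℓ(M) induced by f. Then there is an isomorphism of ℤ_ℓ[G]-modules T_ℓ(M)/(1 − T_ℓ(f))·T_ℓ(M) ≅ ℤ_ℓ ⊗_ℤ M^f. -/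
open scoped TensorProduct

noncomputable section

set_option linter.unusedSectionVars false
set_option synthInstance.maxHeartbeats 1000000
set_option maxHeartbeats 1000000

variable (ℓ : ℕ) [Fact ℓ.Prime] (M : Type*) [AddCommGroup M]

/-- The `ℓ`-adic Tate module of an abelian group `M`: the inverse limit of the system
`(M[ℓⁿ])_{n ≥ 1}` with transition maps given by multiplication by `ℓ`; realized as
the subgroup of sequences `(x_n)_{n ≥ 0}` with `x_n ∈ M[ℓ^(n+1)]` and
`ℓ·x_(n+1) = x_n`. -/
def TateSub : Submodule ℤ (∀ _ : ℕ, M) where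
  carrier := {x | (∀ n : ℕ, (ℓ : ℤ) ^ (n + 1) • x n = 0) ∧
    ∀ n : ℕ, (ℓ : ℤ) • x (n + 1) = x n}
  zero_mem' := ⟨fun _ => smul_zero _, fun _ => smul_zero _⟩
  add_mem' := by
    rintro a b ⟨ha1, ha2⟩ ⟨hb1, hb2⟩
    exact ⟨fun n => by simp only [Pi.add_apply, smul_add, ha1 n, hb1 n, add_zero],
      fun n => by simp only [Pi.add_apply, smul_add, ha2 n, hb2 n]⟩
  smul_mem' := by
    rintro c x ⟨h1, h2⟩
    refine ⟨fun n => ?_, fun n => ?_⟩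
    · rw [Pi.smul_apply, smul_comm, h1 n, smul_zero]
    · rw [Pi.smul_apply, Pi.smul_apply, smul_comm, h2 n]

/-- If `a ≡ b mod ℓᵏ` then `a` and `b` act in the same way on elements killed
by `ℓᵏ`. -/
theorem smul_congr_of_dvd {k : ℕ} {a b : ℤ} (h : (ℓ : ℤ) ^ k ∣ a - b) {m : M}
    (hm : (ℓ : ℤ) ^ k • m = 0) : a • m = b • m := by
  obtain ⟨c, hc⟩ := h
  rw [← sub_eq_zero, ← sub_smul, hc, mul_comm, mul_smul, hm, smul_zero]

/-- Transfer of divisibility from `ℤ_ℓ` to `ℤ`. -/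
theorem int_dvd_of_mem_span {k : ℕ} {a : ℤ}
    (h : ((a : ℤ_[ℓ])) ∈ Ideal.span {((ℓ : ℤ_[ℓ])) ^ k}) : (ℓ : ℤ) ^ k ∣ a := by
  have h1 : ‖(a : ℤ_[ℓ])‖ ≤ (ℓ : ℝ) ^ (-(k : ℤ)) :=
    (PadicInt.norm_le_pow_iff_mem_span_pow _ _).mpr h
  have h2 := (PadicInt.norm_int_le_pow_iff_dvd (p := ℓ) (k := a) (n := k)).mp h1
  exact_mod_cast h2

/-- Two integers approximating the same `p`-adic integer modulo `ℓᵏ` act in the same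
way on elements killed by `ℓᵏ`. -/
theorem padic_smul_congr {k : ℕ} {c : ℤ_[ℓ]} {a b : ℤ}
    (hca : c - (a : ℤ_[ℓ]) ∈ Ideal.span {((ℓ : ℤ_[ℓ])) ^ k})
    (hcb : c - (b : ℤ_[ℓ]) ∈ Ideal.span {((ℓ : ℤ_[ℓ])) ^ k}) {m : M}
    (hm : (ℓ : ℤ) ^ k • m = 0) : a • m = b • m := by
  refine smul_congr_of_dvd ℓ M ?_ hm
  refine int_dvd_of_mem_span ℓ ?_
  have h3 := Ideal.sub_mem _ hcb hca
  simpa using h3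

theorem appr_span (c : ℤ_[ℓ]) (k : ℕ) :
    c - ((c.appr k : ℤ) : ℤ_[ℓ]) ∈ Ideal.span {((ℓ : ℤ_[ℓ])) ^ k} := by
  have h := PadicInt.appr_spec k c
  simpa using h

theorem appr_succ_dvd (c : ℤ_[ℓ]) (n : ℕ) :
    (ℓ : ℤ) ^ (n + 1) ∣ ((c.appr (n + 2) : ℤ) - (c.appr (n + 1) : ℤ)) := by
  apply int_dvd_of_mem_span ℓ
  have h2 : c - ((c.appr (n + 2) : ℤ) : ℤ_[ℓ]) ∈ Ideal.span {((ℓ : ℤ_[ℓ])) ^ (n + 1)} := by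
    refine Ideal.span_singleton_le_span_singleton.mpr
      (pow_dvd_pow _ (by omega)) (appr_span ℓ c (n + 2))
  have h1 := appr_span ℓ c (n + 1)
  have h3 := Ideal.sub_mem _ h1 h2
  simpa using h3

/-- The `ℤ_ℓ`-scalar multiplication on the Tate module: a `p`-adic integer acts on
the level-`n` component through its integer approximation modulo `ℓ^(n+1)`. -/
instance : SMul ℤ_[ℓ] (TateSub ℓ M) where
  smul c x := ⟨fun n => ((c.appr (n + 1) : ℤ)) • x.val n, by
    refine ⟨fun n => ?_, fun n => ?_⟩
    · rw [smul_comm, x.prop.1 n, smul_zero]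
    · have h0 := appr_succ_dvd ℓ c n
      have hd : (ℓ : ℤ) ^ (n + 2) ∣
          ((ℓ : ℤ) * (c.appr (n + 2) : ℤ) - (c.appr (n + 1) : ℤ) * (ℓ : ℤ)) := by
        obtain ⟨t, ht⟩ := h0
        exact ⟨t, by rw [show (ℓ : ℤ) * (c.appr (n + 2) : ℤ) - (c.appr (n + 1) : ℤ) * (ℓ : ℤ)
          = (ℓ : ℤ) * ((c.appr (n + 2) : ℤ) - (c.appr (n + 1) : ℤ)) by ring, ht]; ring⟩
      calc (ℓ : ℤ) • ((c.appr (n + 2) : ℤ) • x.val (n + 1))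
          = ((ℓ : ℤ) * (c.appr (n + 2) : ℤ)) • x.val (n + 1) := (mul_smul _ _ _).symm
        _ = ((c.appr (n + 1) : ℤ) * (ℓ : ℤ)) • x.val (n + 1) :=
            smul_congr_of_dvd ℓ M hd (x.prop.1 (n + 1))
        _ = (c.appr (n + 1) : ℤ) • ((ℓ : ℤ) • x.val (n + 1)) := mul_smul _ _ _
        _ = (c.appr (n + 1) : ℤ) • x.val n := by rw [x.prop.2 n]⟩

theorem tate_smul_coe (c : ℤ_[ℓ]) (x : TateSub ℓ M) (n : ℕ) :
    (((c • x : TateSub ℓ M) : ∀ _ : ℕ, M)) n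
      = ((c.appr (n + 1) : ℤ)) • (x : ∀ _ : ℕ, M) n :=
  rfl

instance : MulAction ℤ_[ℓ] (TateSub ℓ M) where
  one_smul x := Subtype.ext <| funext fun n => by
    rw [tate_smul_coe]
    have h := padic_smul_congr ℓ M (a := ((1 : ℤ_[ℓ]).appr (n + 1) : ℤ)) (b := 1)
      (appr_span ℓ 1 (n + 1)) (by simp) (x.prop.1 n)
    rw [h, one_smul]
  mul_smul c d x := Subtype.ext <| funext fun n => by
    simp only [tate_smul_coe, smul_smul]
    refine padic_smul_congr ℓ M (appr_span ℓ (c * d) (n + 1)) ?_ (x.prop.1 n)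
    have h1 := Ideal.mul_mem_left _ c (appr_span ℓ d (n + 1))
    have h2 := Ideal.mul_mem_right ((d.appr (n + 1) : ℤ) : ℤ_[ℓ]) _
      (appr_span ℓ c (n + 1))
    have h3 := Ideal.add_mem _ h1 h2
    have heq : c * d - (((c.appr (n + 1) : ℤ) * (d.appr (n + 1) : ℤ) : ℤ) : ℤ_[ℓ])
        = c * (d - ((d.appr (n + 1) : ℤ) : ℤ_[ℓ]))
          + (c - ((c.appr (n + 1) : ℤ) : ℤ_[ℓ])) * ((d.appr (n + 1) : ℤ) : ℤ_[ℓ]) := by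
      push_cast; ring
    rw [heq]; exact h3

instance : DistribMulAction ℤ_[ℓ] (TateSub ℓ M) where
  smul_zero c := Subtype.ext <| funext fun n => by
    rw [tate_smul_coe]; simp
  smul_add c x y := Subtype.ext <| funext fun n => by
    simp only [tate_smul_coe, Submodule.coe_add, Pi.add_apply, smul_add]

/-- The `ℤ_ℓ`-module structure on the `ℓ`-adic Tate module. -/
instance : Module ℤ_[ℓ] (TateSub ℓ M) where
  add_smul c d x := Subtype.ext <| funext fun n => by
    simp only [tate_smul_coe, Submodule.coe_add, Pi.add_apply, ← add_smul]
    refine padic_smul_congr ℓ M (appr_span ℓ (c + d) (n + 1)) ?_ (x.prop.1 n)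
    have h3 := Ideal.add_mem _ (appr_span ℓ c (n + 1)) (appr_span ℓ d (n + 1))
    have heq : c + d - (((c.appr (n + 1) : ℤ) + (d.appr (n + 1) : ℤ) : ℤ) : ℤ_[ℓ])
        = (c - ((c.appr (n + 1) : ℤ) : ℤ_[ℓ])) + (d - ((d.appr (n + 1) : ℤ) : ℤ_[ℓ])) := by
      push_cast; ring
    rw [heq]; exact h3
  zero_smul x := Subtype.ext <| funext fun n => by
    rw [tate_smul_coe]
    have h := padic_smul_congr ℓ M (a := ((0 : ℤ_[ℓ]).appr (n + 1) : ℤ)) (b := 0)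
      (appr_span ℓ 0 (n + 1)) (by simp) (x.prop.1 n)
    rw [h, zero_smul]
    simp

/-- The `ℤ_ℓ`-linear endomorphism `T_ℓ(f)` of the Tate module induced by a
`ℤ`-linear endomorphism `f` of `M`. -/
def tateEnd (f : M →ₗ[ℤ] M) : TateSub ℓ M →ₗ[ℤ_[ℓ]] TateSub ℓ M where
  toFun x := ⟨fun n => f (x.val n),
    ⟨fun n => by rw [← map_smul, x.prop.1 n, map_zero],
     fun n => by rw [← map_smul, x.prop.2 n]⟩⟩
  map_add' x y := Subtype.ext <| funext fun n => by
    simp [map_add]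
  map_smul' c x := Subtype.ext <| funext fun n => map_smul f _ _

/-- The `ℤ_ℓ`-linear action of a group element `σ` on the Tate module. -/
def tateGAct {G : Type*} [CommGroup G] [DistribMulAction G M] (σ : G) :
    TateSub ℓ M →ₗ[ℤ_[ℓ]] TateSub ℓ M where
  toFun x := ⟨fun n => σ • x.val n,
    ⟨fun n => by
      have h := map_zsmul (DistribMulAction.toAddMonoidHom M σ)
        ((ℓ : ℤ) ^ (n + 1)) (x.val n)
      simp only [DistribMulAction.toAddMonoidHom_apply] at h
      show (ℓ : ℤ) ^ (n + 1) • (σ • x.val n) = 0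
      rw [← h, x.prop.1 n, smul_zero],
     fun n => by
      have h := map_zsmul (DistribMulAction.toAddMonoidHom M σ) ((ℓ : ℤ)) (x.val (n + 1))
      simp only [DistribMulAction.toAddMonoidHom_apply] at h
      show (ℓ : ℤ) • (σ • x.val (n + 1)) = σ • x.val n
      rw [← h, x.prop.2 n]⟩⟩
  map_add' x y := Subtype.ext <| funext fun n => by
    simp [smul_add]
  map_smul' c x := Subtype.ext <| funext fun n =>
    map_zsmul (DistribMulAction.toAddMonoidHom M σ) _ _

/-- The action of a group element `σ` on the fixed submodule `M^f`, for a
`G`-equivariant endomorphism `f`. -/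
def fixedGAct {G : Type*} [CommGroup G] [DistribMulAction G M] (f : M →ₗ[ℤ] M)
    (hf : ∀ (σ : G) (m : M), f (σ • m) = σ • f m) (σ : G) :
    LinearMap.ker ((LinearMap.id : M →ₗ[ℤ] M) - f) →ₗ[ℤ]
      LinearMap.ker ((LinearMap.id : M →ₗ[ℤ] M) - f) where
  toFun m := ⟨σ • m.val, by
    have hm := LinearMap.mem_ker.mp m.prop
    simp only [LinearMap.sub_apply, LinearMap.id_apply, sub_eq_zero] at hm
    rw [LinearMap.mem_ker]
    simp only [LinearMap.sub_apply, LinearMap.id_apply, sub_eq_zero]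
    rw [hf σ m.val, ← hm]⟩
  map_add' x y := Subtype.ext (smul_add σ x.val y.val)
  map_smul' c x := Subtype.ext
    (map_zsmul (DistribMulAction.toAddMonoidHom M σ) c x.val)

theorem tate_intCast_smul_apply (a : ℤ) (x : TateSub ℓ M) (n : ℕ) :
    ((a : ℤ_[ℓ]) • x).val n = a • x.val n :=
  padic_smul_congr ℓ M (appr_span ℓ (a : ℤ_[ℓ]) (n + 1)) (by simp) (x.prop.1 n)

theorem tate_pow_smul_apply (k : ℕ) (x : TateSub ℓ M) (n : ℕ) :
    (((ℓ : ℤ_[ℓ]) ^ k) • x).val n = (ℓ : ℤ) ^ k • x.val n := by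
  rw [← tate_intCast_smul_apply]
  push_cast
  rfl

theorem tate_pow_smul_shift (x : TateSub ℓ M) (n k : ℕ) :
    (ℓ : ℤ) ^ k • x.val (n + k) = x.val n := by
  induction k with
  | zero => simp
  | succ k ih => rw [pow_succ, mul_smul, ← add_assoc, x.prop.2, ih]

/-- An element of the Tate module whose component of index `s` vanishes is divisible
by `ℓ^(s+1)`. -/
theorem exists_pow_smul_eq_of_apply_eq_zero (y : TateSub ℓ M) (s : ℕ) (h : y.val s = 0) :
    ∃ z : TateSub ℓ M, (ℓ : ℤ_[ℓ]) ^ (s + 1) • z = y := by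
  refine ⟨⟨fun n => y.val (n + (s + 1)), fun n => ?_, fun n => ?_⟩, ?_⟩
  · beta_reduce
    rw [show n + (s + 1) = s + (n + 1) by omega, tate_pow_smul_shift, h]
  · beta_reduce
    rw [show n + 1 + (s + 1) = n + (s + 1) + 1 by omega, y.prop.2]
  · refine Subtype.ext (funext fun n => ?_)
    rw [tate_pow_smul_apply]
    exact tate_pow_smul_shift ℓ M y n (s + 1)

/-- If multiplication by `ℓ` is surjective on the `ℓ`-power torsion, then the Tate module
surjects onto each torsion level. -/
theorem exists_tate_apply_eq
    (hsurj : ∀ n : ℕ, 1 ≤ n → ∀ m : M, (ℓ : ℤ) ^ n • m = 0 →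
      ∃ m' : M, (ℓ : ℤ) ^ (n + 1) • m' = 0 ∧ (ℓ : ℤ) • m' = m)
    (s : ℕ) (m : M) (hm : (ℓ : ℤ) ^ (s + 1) • m = 0) :
    ∃ y : TateSub ℓ M, y.val s = m := by
  choose! g hg1 hg2 using hsurj
  let w : ℕ → M := fun n => Nat.rec m (fun k v => g (s + 1 + k) v) n
  have hw1 : ∀ k, (ℓ : ℤ) ^ (s + 1 + k) • w k = 0 := by
    intro k
    induction k with
    | zero => exact hm
    | succ k ih => exact hg1 (s + 1 + k) (by omega) (w k) ih
  have hw2 : ∀ k, (ℓ : ℤ) • w (k + 1) = w k := fun k =>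
    hg2 (s + 1 + k) (by omega) (w k) (hw1 k)
  have hw3 : ∀ k, (ℓ : ℤ) ^ k • w k = m := by
    intro k
    induction k with
    | zero => simp [w]
    | succ k ih => rw [pow_succ, mul_smul, hw2, ih]
  refine ⟨⟨fun n => (ℓ : ℤ) ^ s • w n, fun n => ?_, fun n => ?_⟩, hw3 s⟩
  · rw [← mul_smul, ← pow_add, show n + 1 + s = s + 1 + n by omega, hw1]
  · rw [smul_comm, hw2]

/-- An endomorphism of a finite free module admits an adjugate. -/
theorem LinearMap.exists_comp_eq_det_smul_id {R N : Type*} [CommRing R] [AddCommGroup N]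
    [Module R N] [Module.Free R N] [Module.Finite R N] (φ : N →ₗ[R] N) :
    ∃ ψ : N →ₗ[R] N, φ ∘ₗ ψ = LinearMap.det φ • LinearMap.id := by
  classical
  let b := Module.Free.chooseBasis R N
  refine ⟨Matrix.toLin b b (LinearMap.toMatrix b b φ).adjugate, ?_⟩
  conv_lhs => rw [← Matrix.toLin_toMatrix b b φ]
  rw [← Matrix.toLin_mul, LinearMap.toMatrix_toLin, Matrix.mul_adjugate, map_smul,
    Matrix.toLin_one, LinearMap.det_toMatrix]

/-- An injective endomorphism of a finite free `ℤ_ℓ`-module has a right inverse up to any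
sufficiently high power of `ℓ`. -/
theorem PadicInt.exists_comp_eq_pow_smul_id {N : Type*} [AddCommGroup N]
    [Module ℤ_[ℓ] N] [Module.Free ℤ_[ℓ] N] [Module.Finite ℤ_[ℓ] N] (φ : N →ₗ[ℤ_[ℓ]] N)
    (hφ : Function.Injective φ) :
    ∃ r : ℕ, ∀ t, r ≤ t → ∃ ψ : N →ₗ[ℤ_[ℓ]] N, ∀ x, φ (ψ x) = (ℓ : ℤ_[ℓ]) ^ t • x := by
  have hd : LinearMap.det φ ≠ 0 := fun h =>
    (LinearMap.bot_lt_ker_of_det_eq_zero h).ne' (LinearMap.ker_eq_bot.mpr hφ)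
  obtain ⟨ψ, hψ⟩ := LinearMap.exists_comp_eq_det_smul_id φ
  have hu := PadicInt.unitCoeff_spec hd
  set u := PadicInt.unitCoeff hd
  set r := (LinearMap.det φ).valuation
  refine ⟨r, fun t ht => ⟨((ℓ : ℤ_[ℓ]) ^ (t - r) * (↑u⁻¹ : ℤ_[ℓ])) • ψ, fun x => ?_⟩⟩
  have hx : φ (ψ x) = LinearMap.det φ • x := LinearMap.congr_fun hψ x
  rw [LinearMap.smul_apply, map_smul, hx, smul_smul, hu]
  congr 1
  rw [show (ℓ : ℤ_[ℓ]) ^ (t - r) * (↑u⁻¹ : ℤ_[ℓ]) * (↑u * (ℓ : ℤ_[ℓ]) ^ r)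
    = ((↑u⁻¹ : ℤ_[ℓ]) * ↑u) * ((ℓ : ℤ_[ℓ]) ^ (t - r) * (ℓ : ℤ_[ℓ]) ^ r) by ring,
    Units.inv_mul, one_mul, ← pow_add, Nat.sub_add_cancel ht]

/-- `ℓ^r`-torsion in a group killed by `ℓ^r * u`, with `u` prime to `ℓ`, embeds in the tensor
product with `ℤ_ℓ`. -/
theorem PadicInt.eq_zero_of_one_tmul_eq_zero {K : Type*} [AddCommGroup K] (r : ℕ) (u : ℤ)
    (hu : IsCoprime ((ℓ : ℤ) ^ r) u) (hK : ∀ k : K, (ℓ : ℤ) ^ r • u • k = 0)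
    {k : K} (hk : (ℓ : ℤ) ^ r • k = 0) (h : (1 : ℤ_[ℓ]) ⊗ₜ[ℤ] k = 0) : k = 0 := by
  let F : ℤ_[ℓ] →+ K →+ K :=
    { toFun := fun c => ((c.appr r : ℤ) * u) • AddMonoidHom.id K
      map_zero' := by
        ext k
        have := padic_smul_congr ℓ K (b := 0) (appr_span ℓ 0 r) (by simp) (hK k)
        simpa [mul_smul] using this
      map_add' := fun c d => by
        ext k
        have hcd : c + d - (((c.appr r : ℤ) + (d.appr r : ℤ) : ℤ) : ℤ_[ℓ]) ∈
            Ideal.span {(ℓ : ℤ_[ℓ]) ^ r} := by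
          have h3 := Ideal.add_mem _ (appr_span ℓ c r) (appr_span ℓ d r)
          convert h3 using 1
          push_cast
          ring
        have := padic_smul_congr ℓ K (appr_span ℓ (c + d) r) hcd (hK k)
        simpa only [AddMonoidHom.add_apply, AddMonoidHom.smul_apply, AddMonoidHom.id_apply,
          mul_smul, add_smul] using this }
  have hF : F 1 k = 0 := by
    have := congrArg (TensorProduct.liftAddHom F
      (fun n c k => by rw [map_zsmul, map_zsmul]; rfl)) h
    simpa using this
  have h1 := padic_smul_congr ℓ K (b := 1) (appr_span ℓ 1 r) (by simp) (hK k)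
  have huk : u • k = 0 := by
    rw [one_smul, ← mul_smul] at h1
    rw [← h1]
    exact hF
  obtain ⟨a, b, hab⟩ := hu
  rw [← one_smul ℤ k, ← hab, add_smul, mul_smul, mul_smul, hk, huk, smul_zero, smul_zero,
    add_zero]

/-- On an element killed by `ℓ^r`, a `p`-adic integer may be replaced by its approximation
modulo `ℓ^r`. -/
theorem PadicInt.tmul_eq_appr_tmul {K : Type*} [AddCommGroup K] (r : ℕ) (c : ℤ_[ℓ])
    {k : K} (hk : (ℓ : ℤ) ^ r • k = 0) :
    c ⊗ₜ[ℤ] k = (1 : ℤ_[ℓ]) ⊗ₜ[ℤ] ((c.appr r : ℤ) • k) := by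
  obtain ⟨d, hd⟩ := Ideal.mem_span_singleton.mp (appr_span ℓ c r)
  rw [← TensorProduct.smul_tmul, ← sub_eq_zero, ← TensorProduct.sub_tmul, zsmul_one, hd,
    show (ℓ : ℤ_[ℓ]) ^ r * d = ((ℓ : ℤ) ^ r) • d by simp, TensorProduct.smul_tmul, hk,
    TensorProduct.tmul_zero]

/-- A finite abelian group is killed by a product `ℓ^s * u` with `u` prime to `ℓ`. -/
theorem exists_pow_mul_smul_eq_zero (K : Type*) [AddCommGroup K] [Finite K] :
    ∃ (s : ℕ) (u : ℤ), IsCoprime (ℓ : ℤ) u ∧ ∀ k : K, (ℓ : ℤ) ^ s • u • k = 0 := by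
  have hℓ : ℓ.Prime := Fact.out
  obtain ⟨s, u, hu, hc⟩ := Nat.exists_eq_pow_mul_and_not_dvd
    (Nat.card_pos (α := K)).ne' ℓ hℓ.ne_one
  refine ⟨s, u, Nat.isCoprime_iff_coprime.mpr ((Nat.Prime.coprime_iff_not_dvd hℓ).mpr hu),
    fun k => ?_⟩
  have := card_nsmul_eq_zero' (x := k)
  rw [hc] at this
  rw [← mul_smul]
  exact_mod_cast this

/-- If the fixed subgroup of `f` is killed by `ℓ^s * u` with `u` prime to `ℓ`, then
`1 - T_ℓ(f)` is injective. -/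
theorem id_sub_tateEnd_injective (f : M →ₗ[ℤ] M) (s : ℕ) (u : ℤ) (hu : IsCoprime (ℓ : ℤ) u)
    (hK : ∀ k : LinearMap.ker ((LinearMap.id : M →ₗ[ℤ] M) - f), (ℓ : ℤ) ^ s • u • k = 0) :
    Function.Injective
      ((LinearMap.id : TateSub ℓ M →ₗ[ℤ_[ℓ]] TateSub ℓ M) - tateEnd ℓ M f) := by
  rw [injective_iff_map_eq_zero]
  intro x hx
  have hmem : ∀ n, x.val n ∈ LinearMap.ker ((LinearMap.id : M →ₗ[ℤ] M) - f) := fun n =>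
    congrFun (congrArg Subtype.val hx) n
  refine Subtype.ext (funext fun n => ?_)
  have h1 : u • x.val n = 0 := by
    have := congrArg Subtype.val (hK ⟨_, hmem (n + s)⟩)
    rw [← tate_pow_smul_shift ℓ M x n s, smul_comm]
    exact this
  obtain ⟨a, b, hab⟩ := hu.pow_left (m := n + 1)
  change x.val n = 0
  rw [← one_smul ℤ (x.val n), ← hab, add_smul, mul_smul, mul_smul, h1, x.prop.1 n, smul_zero,
    smul_zero, add_zero]

/-- **Lemma 3.1.5.** Let `G` be a finite abelian group, `ℓ` a prime, `M` a
`ℤ[G]`-module and `f` a `G`-equivariant endomorphism of `M`.  Assume that the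
multiplication-by-`ℓ` maps `M[ℓ^(n+1)] → M[ℓⁿ]` are surjective for `n ≥ 1`, that the
Tate module `T_ℓ(M)` is a free `ℤ_ℓ`-module of finite rank, and that the fixed
subgroup `M^f` is finite.  Then there is an isomorphism of `ℤ_ℓ[G]`-modules
`T_ℓ(M)/(1 − T_ℓ(f))·T_ℓ(M) ≅ ℤ_ℓ ⊗ M^f`, i.e. a `ℤ_ℓ`-linear equivalence which is
moreover `G`-equivariant. -/
theorem tate_quotient_iso_fixed
    {G : Type*} [CommGroup G] [Fintype G] [DistribMulAction G M]
    (f : M →ₗ[ℤ] M) (hf : ∀ (σ : G) (m : M), f (σ • m) = σ • f m)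
    (hsurj : ∀ n : ℕ, 1 ≤ n → ∀ m : M, (ℓ : ℤ) ^ n • m = 0 →
      ∃ m' : M, (ℓ : ℤ) ^ (n + 1) • m' = 0 ∧ (ℓ : ℤ) • m' = m)
    [Module.Free ℤ_[ℓ] (TateSub ℓ M)] [Module.Finite ℤ_[ℓ] (TateSub ℓ M)]
    [Finite (LinearMap.ker ((LinearMap.id : M →ₗ[ℤ] M) - f))] :
    ∃ e : ((TateSub ℓ M) ⧸
          LinearMap.range ((LinearMap.id : TateSub ℓ M →ₗ[ℤ_[ℓ]] TateSub ℓ M)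
            - tateEnd ℓ M f)) ≃ₗ[ℤ_[ℓ]]
        (ℤ_[ℓ] ⊗[ℤ] (LinearMap.ker ((LinearMap.id : M →ₗ[ℤ] M) - f))),
      ∀ (σ : G) (x : TateSub ℓ M),
        e (Submodule.Quotient.mk (tateGAct ℓ M σ x)) =
          LinearMap.lTensor ℤ_[ℓ] (fixedGAct M f hf σ)
            (e (Submodule.Quotient.mk x)) := by
  obtain ⟨s, u, hu, hK⟩ :=
    exists_pow_mul_smul_eq_zero ℓ (LinearMap.ker ((LinearMap.id : M →ₗ[ℤ] M) - f))
  have hinj := id_sub_tateEnd_injective ℓ M f s u hu hK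
  obtain ⟨r, hr⟩ := PadicInt.exists_comp_eq_pow_smul_id ℓ _ hinj
  obtain ⟨t, hrt, hst⟩ : ∃ t, r ≤ t + 1 ∧ s ≤ t + 1 := ⟨r + s, by omega, by omega⟩
  obtain ⟨Y, hY⟩ := hr (t + 1) hrt
  replace hK : ∀ k : LinearMap.ker ((LinearMap.id : M →ₗ[ℤ] M) - f),
      (ℓ : ℤ) ^ (t + 1) • u • k = 0 := fun k => by
    rw [← Nat.sub_add_cancel hst, pow_add, mul_smul, hK, smul_zero]
  clear hst hrt hr
  set φ := (LinearMap.id : TateSub ℓ M →ₗ[ℤ_[ℓ]] TateSub ℓ M) - tateEnd ℓ M f with hφ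
  have hφ_val : ∀ (x : TateSub ℓ M) (n : ℕ), (φ x).val n = x.val n - f (x.val n) :=
    fun _ _ => rfl
  have hpow_val : ∀ x : TateSub ℓ M, ((ℓ : ℤ_[ℓ]) ^ (t + 1) • x).val t = 0 := fun x => by
    rw [tate_pow_smul_apply, x.prop.1]
  have hY_mem : ∀ x, (Y x).val t ∈ LinearMap.ker ((LinearMap.id : M →ₗ[ℤ] M) - f) :=
    fun x => by
      rw [LinearMap.mem_ker, LinearMap.sub_apply, LinearMap.id_apply, ← hφ_val, hY, hpow_val]
  -- `ψ x` is the component of index `t` of the unique preimage of `ℓ^(t+1) • x` under `φ`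
  let ψ : TateSub ℓ M → LinearMap.ker ((LinearMap.id : M →ₗ[ℤ] M) - f) :=
    fun x => ⟨(Y x).val t, hY_mem x⟩
  have hψ_tors : ∀ x, (ℓ : ℤ) ^ (t + 1) • ψ x = 0 := fun x => Subtype.ext ((Y x).prop.1 t)
  let Ψ : TateSub ℓ M →ₗ[ℤ_[ℓ]]
      ℤ_[ℓ] ⊗[ℤ] (LinearMap.ker ((LinearMap.id : M →ₗ[ℤ] M) - f)) :=
    { toFun := fun x => 1 ⊗ₜ ψ x
      map_add' := fun x y => by
        rw [← TensorProduct.tmul_add]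
        congr 1
        refine Subtype.ext ?_
        change (Y (x + y)).val t = (Y x).val t + (Y y).val t
        rw [map_add]
        rfl
      map_smul' := fun c x => by
        rw [RingHom.id_apply, TensorProduct.smul_tmul', smul_eq_mul, mul_one,
          PadicInt.tmul_eq_appr_tmul ℓ (t + 1) c (hψ_tors x)]
        congr 1
        refine Subtype.ext ?_
        change (Y (c • x)).val t = (c.appr (t + 1) : ℤ) • (Y x).val t
        rw [map_smul, tate_smul_coe] }
  have hΨ_apply : ∀ x, Ψ x = 1 ⊗ₜ ψ x := fun _ => rfl
  have hker : LinearMap.ker Ψ = LinearMap.range φ := by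
    ext x
    rw [LinearMap.mem_ker, LinearMap.mem_range]
    constructor
    · intro h
      have h0 : ψ x = 0 := PadicInt.eq_zero_of_one_tmul_eq_zero ℓ (t + 1) u hu.pow_left hK
        (hψ_tors x) h
      obtain ⟨z, hz⟩ := exists_pow_smul_eq_of_apply_eq_zero ℓ M (Y x) t
        (congrArg Subtype.val h0)
      refine ⟨z, smul_right_injective _ (pow_ne_zero (t + 1)
        (Nat.cast_ne_zero.mpr (Fact.out : ℓ.Prime).ne_zero : (ℓ : ℤ_[ℓ]) ≠ 0)) ?_⟩
      change _ • φ z = _ • x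
      rw [← map_smul, hz, hY]
    · rintro ⟨z, rfl⟩
      have h1 : Y (φ z) = (ℓ : ℤ_[ℓ]) ^ (t + 1) • z := hinj (by rw [hY, map_smul])
      have h2 : ψ (φ z) = 0 := Subtype.ext (by
        change (Y (φ z)).val t = 0
        rw [h1, hpow_val])
      rw [hΨ_apply, h2, TensorProduct.tmul_zero]
  have hψ_surj : ∀ k : LinearMap.ker ((LinearMap.id : M →ₗ[ℤ] M) - f),
      (ℓ : ℤ) ^ (t + 1) • k = 0 → ∃ x, ψ x = k := by
    intro k hk
    obtain ⟨y, hy⟩ := exists_tate_apply_eq ℓ M hsurj t k.val (congrArg Subtype.val hk)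
    have hφy : (φ y).val t = 0 := by
      rw [hφ_val, hy]
      exact k.prop
    obtain ⟨x, hx⟩ := exists_pow_smul_eq_of_apply_eq_zero ℓ M (φ y) t hφy
    have hYx : Y x = y := hinj (by rw [hY, hx])
    exact ⟨x, Subtype.ext (by change (Y x).val t = _; rw [hYx, hy])⟩
  have hu_unit : IsUnit (u : ℤ_[ℓ]) := by
    rw [PadicInt.isUnit_iff, PadicInt.norm_intCast_eq_one_iff]
    exact hu.symm
  have hsurjΨ : Function.Surjective Ψ := by
    rw [← LinearMap.range_eq_top, eq_top_iff]
    rintro w -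
    induction w with
    | zero => exact Submodule.zero_mem _
    | add a b ha hb => exact Submodule.add_mem _ ha hb
    | tmul c k =>
      obtain ⟨v, hv⟩ := hu_unit
      obtain ⟨x, hx⟩ := hψ_surj (u • k) (hK k)
      refine ⟨(c * (↑v⁻¹ : ℤ_[ℓ])) • x, ?_⟩
      rw [map_smul, hΨ_apply, hx, TensorProduct.smul_tmul', smul_eq_mul, mul_one,
        ← TensorProduct.smul_tmul, zsmul_eq_mul, ← hv, mul_left_comm, Units.mul_inv, mul_one]
  refine ⟨(Submodule.quotEquivOfEq _ _ hker.symm).trans (Ψ.quotKerEquivOfSurjective hsurjΨ),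
    fun σ x => ?_⟩
  have hYσ : Y (tateGAct ℓ M σ x) = tateGAct ℓ M σ (Y x) := by
    apply hinj
    have hcomm : φ (tateGAct ℓ M σ (Y x)) = tateGAct ℓ M σ (φ (Y x)) :=
      Subtype.ext (funext fun n => by
        change σ • (Y x).val n - f (σ • (Y x).val n) = σ • ((Y x).val n - f ((Y x).val n))
        rw [hf, smul_sub])
    rw [hcomm, hY, hY, map_smul]
  change Ψ (tateGAct ℓ M σ x) = LinearMap.lTensor ℤ_[ℓ] (fixedGAct M f hf σ) (Ψ x)
  rw [hΨ_apply, hΨ_apply, LinearMap.lTensor_tmul]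
  congr 1
  refine Subtype.ext ?_
  change (Y (tateGAct ℓ M σ x)).val t = σ • (Y x).val t
  rw [hYσ]
  rfl
end
end

section
/- Let G be a group and let A be an abelian normal subgroup of G such that the quotient group G/A is cyclic. Then the commutator subgroup [G,G] of G is generated by the commutators [g,a] = g·a·g⁻¹·a⁻¹ with g ∈ G and a ∈ A. -/
/-- If `A` is a normal subgroup with cyclic quotient, then `[G, G] = [G, A]`. -/
theorem commutator_eq_commutator_top_of_isCyclic_quotient
    {G : Type*} [Group G] (A : Subgroup G) [A.Normal] [IsCyclic (G ⧸ A)] :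
    commutator G = ⁅(⊤ : Subgroup G), A⁆ := by
  refine le_antisymm ?_ (Subgroup.commutator_mono le_rfl le_top)
  set N : Subgroup G := ⁅(⊤ : Subgroup G), A⁆
  have hNA : N ≤ A := Subgroup.commutator_le_right ⊤ A
  let f : G ⧸ N →* G ⧸ A := QuotientGroup.map N A (MonoidHom.id G) hNA
  have hf : f.ker ≤ Subgroup.center (G ⧸ N) := by
    intro x hx
    induction x using QuotientGroup.induction_on with
    | H a =>
      have ha : a ∈ A := (QuotientGroup.eq_one_iff a).mp hx
      rw [Subgroup.mem_center_iff]
      intro y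
      induction y using QuotientGroup.induction_on with
      | H g =>
        rw [← commutatorElement_eq_one_iff_mul_comm]
        exact (QuotientGroup.eq_one_iff (g * a * g⁻¹ * a⁻¹)).mpr
          (Subgroup.commutator_mem_commutator (Subgroup.mem_top g) ha)
  rw [commutator_def, Subgroup.commutator_le]
  intro x _ y _
  have := f.isMulCommutative_of_isCyclic_of_ker_le_center hf
  rw [← QuotientGroup.eq_one_iff (N := N)]
  exact commutatorElement_eq_one_iff_mul_comm.mpr
    (this.is_comm.comm (x : G ⧸ N) y)

/-- If `A` is an abelian normal subgroup of a group `G` such that `G/A` is cyclic,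
then the commutator subgroup `[G,G]` is generated by the commutators
`[g,a] = g·a·g⁻¹·a⁻¹` with `g ∈ G` and `a ∈ A`. -/
theorem commutator_eq_closure_commutators_with_abelian_normal
    {G : Type*} [Group G] (A : Subgroup G) [A.Normal]
    (hA : ∀ a ∈ A, ∀ b ∈ A, a * b = b * a)
    (hcyc : IsCyclic (G ⧸ A)) :
    commutator G =
      Subgroup.closure {x : G | ∃ (g a : G), a ∈ A ∧ x = g * a * g⁻¹ * a⁻¹} := by
  rw [commutator_eq_commutator_top_of_isCyclic_quotient A, Subgroup.commutator_def]
  congr 1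
  ext x
  simp [commutatorElement_def, eq_comm]
end

section
/- Let R be a Dedekind domain, let G be a finite abelian group whose order is invertible in R, and let M be a finitely generated R[G]-module. Then M is projective as an R[G]-module if and only if M has no R-torsion (i.e., no nonzero element of M is annihilated by a nonzero element of R). -/
/-- If the order of `G` is invertible in `k`, then a `k[G]`-module that is projective over `k` is
projective over `k[G]`: averaging a `k`-linear section over `G` makes it equivariant. -/
theorem MonoidAlgebra.projective_of_isUnit_card
    {k G M : Type*} [CommRing k] [Group G] [Fintype G] (hcard : IsUnit (Fintype.card G : k))
    [AddCommGroup M] [Module k M] [Module (MonoidAlgebra k G) M]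
    [IsScalarTower k (MonoidAlgebra k G) M] [Module.Projective k M] :
    Module.Projective (MonoidAlgebra k G) M := by
  let f : (M →₀ MonoidAlgebra k G) →ₗ[MonoidAlgebra k G] M := Finsupp.linearCombination _ id
  have hf : Function.Surjective f := Finsupp.linearCombination_id_surjective _ M
  obtain ⟨s, hs⟩ := Module.projective_lifting_property (f.restrictScalars k) LinearMap.id hf
  replace hs (m : M) : f (s m) = m := LinearMap.congr_fun hs m
  refine Module.Projective.of_split (s.equivariantProjection G) f (LinearMap.ext fun m ↦ ?_)
  have hconj (g : G) : f (s.conjugate g m) = m := by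
    rw [LinearMap.conjugate_apply, map_smul, hs, ← mul_smul, MonoidAlgebra.single_mul_single,
      mul_one, inv_mul_cancel, ← MonoidAlgebra.one_def, one_smul]
  rw [LinearMap.comp_apply, LinearMap.equivariantProjection_apply, LinearMap.map_smul_of_tower,
    map_sum]
  simp only [hconj]
  rw [Finset.sum_const, Finset.card_univ, ← Nat.cast_smul_eq_nsmul k, smul_smul,
    ← Fintype.card_eq_nat_card, Ring.inverse_mul_cancel _ hcard, one_smul, LinearMap.id_apply]

/-- Let `R` be a Dedekind domain, `G` a finite abelian group whose order is invertible
in `R`, and `M` a finitely generated `R[G]`-module.  Then `M` is projective over the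
group ring `R[G]` if and only if `M` has no `R`-torsion. -/
theorem projective_iff_no_torsion
    {R : Type*} [CommRing R] [IsDomain R] [IsDedekindDomain R]
    {G : Type*} [CommGroup G] [Fintype G]
    (hg : IsUnit ((Fintype.card G : R)))
    (M : Type*) [AddCommGroup M] [Module R M] [Module (MonoidAlgebra R G) M]
    [IsScalarTower R (MonoidAlgebra R G) M]
    [Module.Finite (MonoidAlgebra R G) M] :
    Module.Projective (MonoidAlgebra R G) M ↔
      ∀ (r : R) (m : M), r • m = 0 → r = 0 ∨ m = 0 := by
  constructor
  · intro _ r m h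
    have : Module.Flat R M := .trans R (MonoidAlgebra R G) M
    exact smul_eq_zero.mp h
  · intro h
    have : Module.IsTorsionFree R M := .of_smul_eq_zero h
    have : Module.Finite R M := .trans (MonoidAlgebra R G) M
    have : Module.FinitePresentation R M := Module.finitePresentation_of_finite R M
    have : Module.Projective R M := Module.Flat.projective_of_finitePresentation
    exact MonoidAlgebra.projective_of_isUnit_card hg
end

section
/- Let G be a finite abelian group of order g. For each orbit ψ of the action of Gal(ℚ̄/ℚ) on the set of characters χ: G → ℚ̄ˣ, choose a representative χ_ψ and let n_ψ be its order. Then the ring homomorphism ℤ[1/g][G] → ∏_ψ ℤ[1/g][ζ_{n_ψ}], sending ∑_{σ∈G} a_σ·σ to the tuple (∑_{σ∈G} a_σ·χ_ψ(σ))_ψ, is an isomorphism of rings, and each factor ℤ[1/g][ζ_{n_ψ}] is a Dedekind domain. -/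
noncomputable section

/-- Two characters `G → ℚ̄ˣ` are equivalent if they are conjugate under the natural
action of `Gal(ℚ̄/ℚ)`. -/
def CharRel {G : Type*} [CommGroup G]
    (χ χ' : G →* (AlgebraicClosure ℚ)ˣ) : Prop :=
  ∃ τ : AlgebraicClosure ℚ ≃ₐ[ℚ] AlgebraicClosure ℚ,
    ∀ σ : G, (χ' σ : AlgebraicClosure ℚ) = τ (χ σ)

/-- The subring `ℤ[1/g][χ(G)]` of `ℚ̄` generated by `1/g` and the values of the
character `χ`; since the values of `χ` generate `ℤ[ζ_n]` where `n` is the order of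
`χ`, this is the ring `ℤ[1/g][ζ_n]`. -/
def charValueSubring {G : Type*} [CommGroup G] [Fintype G]
    (χ : G →* (AlgebraicClosure ℚ)ˣ) : Subring (AlgebraicClosure ℚ) :=
  Subring.closure
    (insert ((Fintype.card G : AlgebraicClosure ℚ))⁻¹
      (Set.range fun σ : G => (χ σ : AlgebraicClosure ℚ)))

/-- The coefficient embedding `ℤ[1/g] → ℚ̄`. -/
def coeffToQbar (G : Type*) [CommGroup G] [Fintype G] :
    Localization.Away ((Fintype.card G : ℤ)) →+* AlgebraicClosure ℚ :=
  IsLocalization.Away.lift (g := Int.castRingHom (AlgebraicClosure ℚ))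
    ((Fintype.card G : ℤ))
    (by
      rw [eq_intCast, Int.cast_natCast]
      exact isUnit_iff_ne_zero.mpr (Nat.cast_ne_zero.mpr Fintype.card_ne_zero))

/-- The evaluation `ℤ[1/g][G] → ℚ̄`, `∑ a_σ·σ ↦ ∑ a_σ·χ(σ)`, at a character `χ`. -/
def charEval {G : Type*} [CommGroup G] [Fintype G]
    (χ : G →* (AlgebraicClosure ℚ)ˣ) :
    MonoidAlgebra (Localization.Away ((Fintype.card G : ℤ))) G →+*
      AlgebraicClosure ℚ :=
  MonoidAlgebra.liftNCRingHom (coeffToQbar G)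
    ((Units.coeHom (AlgebraicClosure ℚ)).comp χ) (fun _ _ => Commute.all _ _)

local notation "ℚbar" => AlgebraicClosure ℚ

open Finset NumberField

/-- `AlgebraicClosure ℚ` is an algebraic closure of `ℚ` for the algebra structure coming from
characteristic zero, which is the one found by instance search. -/
instance isAlgClosure_rat : IsAlgClosure ℚ ℚbar where
  isAlgClosed := inferInstance
  isAlgebraic := by convert! AlgebraicClosure.isAlgebraic ℚ

/-- A subring of a field which is generated by the image of a Dedekind domain and the inverse of
an element of that image is a Dedekind domain. -/
theorem isDedekindDomain_subring_of_inv {A K : Type*} [CommRing A] [IsDedekindDomain A] [Field K]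
    (f : A →+* K) (hf : Function.Injective f) (r : A) (hr : r ≠ 0) (S : Subring K)
    (hfS : ∀ a, f a ∈ S) (hrS : (f r)⁻¹ ∈ S) (hS : ∀ s ∈ S, ∃ (n : ℕ) (a : A), s * f r ^ n = f a) :
    IsDedekindDomain S := by
  let _ : Algebra A S := (f.codRestrict S hfS).toAlgebra
  have hfr : f r ≠ 0 := (map_ne_zero_iff f hf).mpr hr
  have : IsLocalization.Away r S := by
    refine IsLocalization.Away.mk r ?_ ?_ ?_
    · exact IsUnit.of_mul_eq_one ⟨(f r)⁻¹, hrS⟩ (Subtype.ext (mul_inv_cancel₀ hfr))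
    · rintro ⟨s, hs⟩
      obtain ⟨n, a, h⟩ := hS s hs
      exact ⟨n, a, Subtype.ext h⟩
    · exact fun a b h ↦ ⟨0, by rw [hf (congrArg Subtype.val h)]⟩
  exact IsLocalization.isDedekindDomain A (powers_le_nonZeroDivisors_of_noZeroDivisors hr) S

section Characters

variable {G : Type*} [CommGroup G]

theorem charRel_equivalence : Equivalence (CharRel (G := G)) where
  refl _ := ⟨AlgEquiv.refl, fun _ ↦ rfl⟩
  symm := by
    rintro χ χ' ⟨τ, h⟩
    exact ⟨τ.symm, fun σ ↦ by simp [h]⟩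
  trans := by
    rintro χ χ' χ'' ⟨τ, h⟩ ⟨τ', h'⟩
    exact ⟨τ.trans τ', fun σ ↦ by simp [h, h']⟩

theorem quot_mk_charRel_eq_iff (χ χ' : G →* ℚbarˣ) :
    Quot.mk CharRel χ = Quot.mk CharRel χ' ↔ CharRel χ χ' :=
  charRel_equivalence.quot_mk_eq_iff χ χ'

/-- The character conjugate to `χ` under `τ`. -/
def conjChar (τ : ℚbar ≃ₐ[ℚ] ℚbar) (χ : G →* ℚbarˣ) : G →* ℚbarˣ :=
  (Units.map (τ : ℚbar →* ℚbar)).comp χ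

theorem conjChar_injective (τ : ℚbar ≃ₐ[ℚ] ℚbar) :
    Function.Injective (conjChar (G := G) τ) := fun χ χ' h ↦ by
  ext σ
  exact τ.injective (congrArg Units.val (DFunLike.congr_fun h σ))

theorem quot_mk_conjChar (τ : ℚbar ≃ₐ[ℚ] ℚbar) (χ : G →* ℚbarˣ) :
    Quot.mk CharRel (conjChar τ χ) = Quot.mk CharRel χ :=
  (Quot.sound ⟨τ, fun _ ↦ rfl⟩).symm

variable [Fintype G]

theorem isDedekindDomain_charValueSubring (χ : G →* ℚbarˣ) :
    IsDedekindDomain (charValueSubring χ) := by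
  have : Finite χ.range := Finite.of_surjective _ χ.rangeRestrict_surjective
  obtain ⟨⟨u, σ₀, hσ₀⟩, hu⟩ := IsCyclic.exists_monoid_generator (α := χ.range)
  have hpow (σ : G) : ∃ k : ℕ, (χ σ : ℚbar) = (u : ℚbar) ^ k := by
    obtain ⟨k, hk⟩ := hu ⟨χ σ, σ, rfl⟩
    exact ⟨k, by simpa using congrArg (fun x : χ.range ↦ ((x : ℚbarˣ) : ℚbar)) hk.symm⟩
  set ζ : ℚbar := u.val with hζdef
  have hfin : IsOfFinOrder u := hσ₀ ▸ χ.isOfFinOrder (isOfFinOrder_of_finite σ₀)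
  have : NeZero (orderOf u) := ⟨hfin.orderOf_pos.ne'⟩
  have hζ : IsPrimitiveRoot ζ (orderOf u) :=
    IsPrimitiveRoot.coe_units_iff.mpr (IsPrimitiveRoot.orderOf u)
  let F := IntermediateField.adjoin ℚ {ζ}
  have : IsCyclotomicExtension {orderOf u} ℚ F :=
    hζ.intermediateField_adjoin_isCyclotomicExtension ℚ
  have : NumberField F := IsCyclotomicExtension.numberField {orderOf u} ℚ F
  have hζF : IsPrimitiveRoot (IntermediateField.AdjoinSimple.gen ℚ ζ) (orderOf u) :=
    IsPrimitiveRoot.coe_submonoidClass_iff.mp hζ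
  let f : 𝓞 F →+* ℚbar := (algebraMap F ℚbar).comp (algebraMap (𝓞 F) F)
  have hfζ : f hζF.toInteger = ζ := rfl
  have hf : Function.Injective f :=
    (algebraMap F ℚbar).injective.comp RingOfIntegers.coe_injective
  have hg : ((Fintype.card G : ℕ) : ℚbar) ≠ 0 := Nat.cast_ne_zero.mpr Fintype.card_ne_zero
  refine isDedekindDomain_subring_of_inv f hf (Fintype.card G : 𝓞 F) ?_ _ ?_ ?_ ?_
  · exact Nat.cast_ne_zero.mpr Fintype.card_ne_zero
  · intro a
    have ha : a ∈ Algebra.adjoin ℤ {hζF.toInteger} := by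
      rw [IsCyclotomicExtension.Rat.adjoin_singleton_eq_top hζF]; trivial
    induction ha using Algebra.adjoin_induction with
    | mem x hx =>
      rw [Set.mem_singleton_iff.mp hx, hfζ, hζdef, ← hσ₀]
      exact Subring.subset_closure (Set.mem_insert_of_mem _ ⟨σ₀, rfl⟩)
    | algebraMap n => simp
    | add x y _ _ hx hy => rw [map_add]; exact add_mem hx hy
    | mul x y _ _ hx hy => rw [map_mul]; exact mul_mem hx hy
  · rw [map_natCast]
    exact Subring.subset_closure (Set.mem_insert _ _)
  · intro s hs
    rw [map_natCast]
    induction hs using Subring.closure_induction with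
    | mem x hx =>
      rcases hx with rfl | ⟨σ, rfl⟩
      · exact ⟨1, 1, by simp [hg]⟩
      · obtain ⟨k, hk⟩ := hpow σ
        exact ⟨0, hζF.toInteger ^ k, by rw [map_pow, hfζ, ← hk, pow_zero, mul_one]⟩
    | zero => exact ⟨0, 0, by simp⟩
    | one => exact ⟨0, 1, by simp⟩
    | add x y _ _ hx hy =>
      obtain ⟨m, a, ha⟩ := hx
      obtain ⟨n, b, hb⟩ := hy
      refine ⟨m + n, a * (Fintype.card G : 𝓞 F) ^ n + b * (Fintype.card G : 𝓞 F) ^ m, ?_⟩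
      simp only [map_add, map_mul, map_pow, map_natCast, ← ha, ← hb]
      ring
    | neg x _ hx =>
      obtain ⟨m, a, ha⟩ := hx
      exact ⟨m, -a, by rw [map_neg, ← ha, neg_mul]⟩
    | mul x y _ _ hx hy =>
      obtain ⟨m, a, ha⟩ := hx
      obtain ⟨n, b, hb⟩ := hy
      exact ⟨m + n, a * b, by rw [map_mul, ← ha, ← hb]; ring⟩

theorem coeffToQbar_algebraMap (n : ℤ) :
    coeffToQbar G (algebraMap ℤ _ n) = n :=
  IsLocalization.Away.lift_eq _ _ n

theorem card_mul_coeffToQbar_invSelf :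
    (Fintype.card G : ℚbar) *
      coeffToQbar G (IsLocalization.Away.invSelf (Fintype.card G : ℤ)) = 1 := by
  have h := congrArg (coeffToQbar G) (IsLocalization.Away.mul_invSelf
    (S := Localization.Away (Fintype.card G : ℤ)) (Fintype.card G : ℤ))
  rwa [map_mul, map_one, coeffToQbar_algebraMap, Int.cast_natCast] at h

theorem coeffToQbar_injective : Function.Injective (coeffToQbar G) := by
  refine (IsLocalization.lift_injective_iff _).mpr fun x y ↦ ?_
  have hinj : Function.Injective (algebraMap ℤ (Localization.Away (Fintype.card G : ℤ))) :=
    IsLocalization.injective _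
      (powers_le_nonZeroDivisors_of_noZeroDivisors
        (Nat.cast_ne_zero.mpr (Fintype.card_ne_zero (α := G))))
  rw [hinj.eq_iff]
  exact Int.cast_injective.eq_iff.symm

theorem algEquiv_coeffToQbar (τ : ℚbar ≃ₐ[ℚ] ℚbar) (r : Localization.Away (Fintype.card G : ℤ)) :
    τ (coeffToQbar G r) = coeffToQbar G r := by
  have : (τ : ℚbar →+* ℚbar).comp (coeffToQbar G) = coeffToQbar G :=
    IsLocalization.ringHom_ext (Submonoid.powers (Fintype.card G : ℤ)) (RingHom.ext_int _ _)
  exact DFunLike.congr_fun this r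

theorem charEval_single (χ : G →* ℚbarˣ) (σ : G) (r : Localization.Away (Fintype.card G : ℤ)) :
    charEval χ (MonoidAlgebra.single σ r) = coeffToQbar G r * χ σ :=
  MonoidAlgebra.liftNC_single _ _ _ _

theorem charEval_eq_sum (χ : G →* ℚbarˣ)
    (a : MonoidAlgebra (Localization.Away (Fintype.card G : ℤ)) G) :
    charEval χ a = ∑ σ, coeffToQbar G (a.coeff σ) * χ σ := by
  induction a using MonoidAlgebra.induction_linear with
  | zero => simp
  | add a b ha hb => simp [ha, hb, add_mul, sum_add_distrib]
  | single σ r =>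
    classical
    rw [charEval_single, sum_eq_single σ] <;> simp +contextual [eq_comm]

theorem charEval_eq_algEquiv {χ χ' : G →* ℚbarˣ} {τ : ℚbar ≃ₐ[ℚ] ℚbar}
    (h : ∀ σ, (χ' σ : ℚbar) = τ (χ σ))
    (a : MonoidAlgebra (Localization.Away (Fintype.card G : ℤ)) G) :
    charEval χ' a = τ (charEval χ a) := by
  simp [charEval_eq_sum, h, algEquiv_coeffToQbar]

theorem range_charEval (χ : G →* ℚbarˣ) :
    RingHom.range (R := MonoidAlgebra (Localization.Away (Fintype.card G : ℤ)) G) (charEval χ) =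
      charValueSubring χ := by
  apply le_antisymm
  · rintro _ ⟨a, rfl⟩
    rw [charEval_eq_sum]
    refine sum_mem fun σ _ ↦ mul_mem ?_
      (Subring.subset_closure (Set.mem_insert_of_mem _ ⟨σ, rfl⟩))
    obtain ⟨n, m, h⟩ := IsLocalization.Away.surj (Fintype.card G : ℤ) (a.coeff σ)
    have hg : (Fintype.card G : ℚbar) ≠ 0 := Nat.cast_ne_zero.mpr Fintype.card_ne_zero
    have h' := congrArg (coeffToQbar G) h
    rw [map_mul, map_pow, coeffToQbar_algebraMap, coeffToQbar_algebraMap, Int.cast_natCast] at h'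
    rw [(eq_mul_inv_iff_mul_eq₀ (pow_ne_zero n hg)).mpr h', ← inv_pow]
    exact mul_mem (intCast_mem _ m)
      (pow_mem (Subring.subset_closure (Set.mem_insert _ _)) n)
  · refine (Subring.closure_le).mpr ?_
    rintro _ (rfl | ⟨σ, rfl⟩)
    · refine ⟨MonoidAlgebra.single 1 (IsLocalization.Away.invSelf (Fintype.card G : ℤ)), ?_⟩
      rw [charEval_single, map_one, Units.val_one, mul_one,
        eq_inv_of_mul_eq_one_right card_mul_coeffToQbar_invSelf]
    · exact ⟨MonoidAlgebra.single σ 1, by rw [charEval_single, map_one, one_mul]⟩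

theorem sum_characters_apply [Fintype (G →* ℚbarˣ)] [DecidableEq G] (σ : G) :
    ∑ χ : G →* ℚbarˣ, (χ σ : ℚbar) = if σ = 1 then (Fintype.card G : ℚbar) else 0 := by
  split_ifs with h
  · subst h
    simp [← Nat.card_eq_fintype_card, CommGroup.card_monoidHom_of_hasEnoughRootsOfUnity]
  · obtain ⟨χ, hχ⟩ := CommGroup.exists_apply_ne_one_of_hasEnoughRootsOfUnity G ℚbar h
    refine eq_zero_of_mul_eq_self_left (b := (χ σ : ℚbar)) (by simpa using hχ) ?_
    rw [mul_sum]
    exact Fintype.sum_bijective _ (Group.mulLeft_bijective χ) _ _ fun χ' ↦ by simp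

theorem sum_inv_mul_apply [DecidableEq (G →* ℚbarˣ)] (χ χ' : G →* ℚbarˣ) :
    ∑ σ, (χ σ⁻¹ : ℚbar) * χ' σ = if χ = χ' then (Fintype.card G : ℚbar) else 0 := by
  classical
  have h := sum_hom_units ((Units.coeHom ℚbar).comp (χ⁻¹ * χ'))
  simp only [MonoidHom.comp_apply, MonoidHom.mul_apply, MonoidHom.inv_apply, Units.coeHom_apply,
    Units.val_mul] at h
  simp only [map_inv]
  rw [h, Nat.cast_ite, Nat.cast_zero]
  congr 1
  rw [eq_iff_iff, ← inv_mul_eq_one (a := χ) (b := χ')]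
  constructor
  · intro h1
    ext σ
    simpa using DFunLike.congr_fun h1 σ
  · intro h1
    rw [h1]
    rfl

theorem eq_zero_of_charEval_eq_zero
    (a : MonoidAlgebra (Localization.Away (Fintype.card G : ℤ)) G)
    (h : ∀ χ : G →* ℚbarˣ, charEval χ a = 0) : a = 0 := by
  classical
  have := Fintype.ofFinite (G →* ℚbarˣ)
  ext σ
  refine coeffToQbar_injective ?_
  have key : ∑ χ : G →* ℚbarˣ, (χ σ⁻¹ : ℚbar) * charEval χ a
      = coeffToQbar G (a.coeff σ) * Fintype.card G := by
    have hcol (σ' : G) : ∑ χ : G →* ℚbarˣ, (χ σ⁻¹ : ℚbar) * (coeffToQbar G (a.coeff σ') * χ σ') =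
        if σ⁻¹ * σ' = 1 then coeffToQbar G (a.coeff σ') * Fintype.card G else 0 := by
      rw [← mul_ite_zero, ← sum_characters_apply, mul_sum]
      refine sum_congr rfl fun χ _ ↦ ?_
      rw [map_mul, Units.val_mul]
      ring
    simp_rw [charEval_eq_sum, mul_sum]
    rw [sum_comm]
    simp_rw [hcol, inv_mul_eq_one]
    simp
  simp only [h, mul_zero, sum_const_zero] at key
  have hg : (Fintype.card G : ℚbar) ≠ 0 := Nat.cast_ne_zero.mpr Fintype.card_ne_zero
  simpa [hg] using key.symm

/-- An algebraic integer fixed by the absolute Galois group of `ℚ` is a rational integer. -/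
theorem exists_int_cast_eq_of_fixed {x : ℚbar} (hx : IsIntegral ℤ x)
    (hfix : ∀ τ : ℚbar ≃ₐ[ℚ] ℚbar, τ x = x) : ∃ n : ℤ, (n : ℚbar) = x := by
  have : IsGalois ℚ ℚbar := IsAlgClosure.isGalois ℚ ℚbar
  obtain ⟨q, rfl⟩ := (InfiniteGalois.mem_range_algebraMap_iff_fixed x).mpr hfix
  obtain ⟨n, rfl⟩ := IsIntegrallyClosed.isIntegral_iff.mp
    ((isIntegral_algebraMap_iff (algebraMap ℚ ℚbar).injective).mp hx)
  exact ⟨n, by simp⟩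

theorem exists_int_cast_eq_sum_orbit
    [Fintype (G →* ℚbarˣ)] [DecidableEq (Quot (CharRel (G := G)))]
    (ψ : Quot (CharRel (G := G))) (σ : G) :
    ∃ n : ℤ, (n : ℚbar) = ∑ χ with Quot.mk CharRel χ = ψ, (χ σ : ℚbar) := by
  apply exists_int_cast_eq_of_fixed
  · refine IsIntegral.sum _ fun χ _ ↦ IsIntegral.of_pow (Fintype.card_pos (α := G)) ?_
    rw [← Units.val_pow_eq_pow_val, ← map_pow, pow_card_eq_one, map_one, Units.val_one]
    exact isIntegral_one
  · intro τ
    rw [map_sum, sum_filter, sum_filter]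
    refine Fintype.sum_bijective (conjChar τ)
      (Finite.injective_iff_bijective.mp (conjChar_injective τ)) _ _ fun χ ↦ ?_
    rw [quot_mk_conjChar]
    rfl

/-- The idempotent of `ℤ[1/g][G]` attached to a Galois orbit of characters. -/
theorem exists_charEval_eq_ite [DecidableEq (Quot (CharRel (G := G)))]
    (ψ : Quot (CharRel (G := G))) :
    ∃ e : MonoidAlgebra (Localization.Away (Fintype.card G : ℤ)) G, ∀ χ : G →* ℚbarˣ,
      charEval χ e = if Quot.mk CharRel χ = ψ then 1 else 0 := by
  classical
  have := Fintype.ofFinite (G →* ℚbarˣ)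
  choose n hn using exists_int_cast_eq_sum_orbit ψ
  refine ⟨∑ σ, MonoidAlgebra.single σ (algebraMap ℤ _ (n σ⁻¹) *
    IsLocalization.Away.invSelf (Fintype.card G : ℤ)), fun χ ↦ ?_⟩
  simp_rw [map_sum, charEval_single, map_mul, coeffToQbar_algebraMap, hn, mul_right_comm _ _
    ((χ _ : ℚbarˣ) : ℚbar), ← sum_mul, sum_mul _ _ ((χ _ : ℚbarˣ) : ℚbar)]
  rw [sum_comm]
  simp_rw [sum_inv_mul_apply]
  rw [sum_ite_eq']
  simp only [mem_filter, mem_univ, true_and]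
  split_ifs
  · exact card_mul_coeffToQbar_invSelf
  · exact zero_mul _

end Characters

/-- **The decomposition of `ℤ[1/g][G]` (Remark 1, §1.3).** Let `G` be a finite
abelian group of order `g`.  For each orbit `ψ` of `Gal(ℚ̄/ℚ)` on the characters
`χ : G → ℚ̄ˣ` choose a representative `rep ψ`.  Then the ring homomorphism
`ℤ[1/g][G] → ∏_ψ ℤ[1/g][ζ_{n_ψ}]`, `∑ a_σ·σ ↦ (∑ a_σ·(rep ψ)(σ))_ψ`, is injective
with image exactly the product of the subrings `ℤ[1/g][ζ_{n_ψ}] ⊆ ℚ̄` (hence is a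
ring isomorphism onto this product), and each factor `ℤ[1/g][ζ_{n_ψ}]` is a
Dedekind domain. -/
theorem groupRing_decomposition
    {G : Type*} [CommGroup G] [Fintype G]
    (rep : Quot (CharRel (G := G)) → (G →* (AlgebraicClosure ℚ)ˣ))
    (hrep : ∀ ψ, Quot.mk CharRel (rep ψ) = ψ) :
    Function.Injective (Pi.ringHom fun ψ => charEval (rep ψ)) ∧
    Set.range (Pi.ringHom fun ψ => charEval (rep ψ)) =
      {x : Quot (CharRel (G := G)) → AlgebraicClosure ℚ |
        ∀ ψ, x ψ ∈ charValueSubring (rep ψ)} ∧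
    ∀ ψ, IsDedekindDomain (charValueSubring (rep ψ)) := by
  classical
  refine ⟨?_, ?_, fun ψ ↦ isDedekindDomain_charValueSubring _⟩
  · refine (injective_iff_map_eq_zero _).mpr fun a ha ↦ eq_zero_of_charEval_eq_zero a fun χ ↦ ?_
    obtain ⟨τ, hτ⟩ := (quot_mk_charRel_eq_iff _ _).mp (hrep (Quot.mk CharRel χ))
    have h0 : charEval (rep (Quot.mk CharRel χ)) a = 0 := congrFun ha (Quot.mk CharRel χ)
    rw [charEval_eq_algEquiv hτ, h0, map_zero]
  · ext x
    simp only [Set.mem_ofPred_eq, ← range_charEval]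
    constructor
    · rintro ⟨a, rfl⟩ ψ
      exact ⟨a, rfl⟩
    · intro hx
      choose a ha using hx
      choose e he using exists_charEval_eq_ite (G := G)
      have : Finite (Quot (CharRel (G := G))) := Quot.finite _
      have := Fintype.ofFinite (Quot (CharRel (G := G)))
      refine ⟨∑ ψ, a ψ * e ψ, funext fun ψ ↦ ?_⟩
      change charEval (rep ψ) _ = x ψ
      simp [he, hrep, ha]
end
end

section
/- Let R be a commutative ring, let V be a finitely generated projective R-module, and let f be an R-linear endomorphism of V. Suppose W and W' are R-modules together with R-module isomorphisms V ⊕ W ≅ Rⁿ and V ⊕ W' ≅ Rᵐ. Then the polynomial det_R(1 − (f ⊕ 0_W)·u), computed with respect to a basis of the free module Rⁿ, equals the polynomial det_R(1 − (f ⊕ 0_{W'})·u) computed with respect to a basis of Rᵐ; that is, the polynomial det_R(1 − f·u | V) ∈ R[u] is well defined, independently of the chosen free complement. -/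
open Polynomial

/-- The polynomial `det_R(1 - f·u | V)` computed from a free complement `W` of the
finitely generated projective module `V`, via an isomorphism `e : V ⊕ W ≅ Rⁿ`. -/
noncomputable def detOneSubSMulPoly {R : Type*} [CommRing R]
    (V W : Type*) [AddCommGroup V] [Module R V] [AddCommGroup W] [Module R W]
    (f : V →ₗ[R] V) (n : ℕ) (e : (V × W) ≃ₗ[R] (Fin n → R)) : R[X] :=
  Matrix.det
    ((1 : Matrix (Fin n) (Fin n) R[X]) -
      (X : R[X]) •
        (Matrix.map
          (LinearMap.toMatrix (Pi.basisFun R (Fin n)) (Pi.basisFun R (Fin n))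
            (e.toLinearMap ∘ₗ f.prodMap (0 : W →ₗ[R] W) ∘ₗ e.symm.toLinearMap))
          Polynomial.C))

/-- The reversed characteristic polynomials of `A * B` and `B * A` agree, also for
rectangular matrices. -/
theorem det_one_sub_X_smul_map_mul_comm {R : Type*} [CommRing R] {n m : Type*}
    [Fintype n] [Fintype m] [DecidableEq n] [DecidableEq m]
    (A : Matrix n m R) (B : Matrix m n R) :
    Matrix.det ((1 : Matrix n n R[X]) - (X : R[X]) • (A * B).map C) =
      Matrix.det ((1 : Matrix m m R[X]) - (X : R[X]) • (B * A).map C) := by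
  rw [Matrix.map_mul, Matrix.map_mul, ← Matrix.smul_mul, Matrix.det_one_sub_mul_comm,
    Matrix.mul_smul]

/-- Well-definedness of `det_R(1 - f·u | V)` for a finitely generated projective
module `V`: the polynomial does not depend on the choice of the free complement. -/
theorem detOneSubSMulPoly_independent {R : Type*} [CommRing R]
    (V W W' : Type*) [AddCommGroup V] [Module R V] [Module.Finite R V]
    [Module.Projective R V]
    [AddCommGroup W] [Module R W] [AddCommGroup W'] [Module R W']
    (f : V →ₗ[R] V) (n m : ℕ)
    (e : (V × W) ≃ₗ[R] (Fin n → R)) (e' : (V × W') ≃ₗ[R] (Fin m → R)) :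
    detOneSubSMulPoly V W f n e = detOneSubSMulPoly V W' f m e' := by
  let A : (Fin m → R) →ₗ[R] (Fin n → R) :=
    e.toLinearMap ∘ₗ LinearMap.inl R V W ∘ₗ LinearMap.fst R V W' ∘ₗ e'.symm.toLinearMap
  let B : (Fin n → R) →ₗ[R] (Fin m → R) :=
    e'.toLinearMap ∘ₗ LinearMap.inl R V W' ∘ₗ f ∘ₗ LinearMap.fst R V W ∘ₗ e.symm.toLinearMap
  have hAB : e.toLinearMap ∘ₗ f.prodMap (0 : W →ₗ[R] W) ∘ₗ e.symm.toLinearMap = A ∘ₗ B := by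
    refine LinearMap.ext fun x => ?_
    simp [A, B, LinearMap.prodMap_apply]
  have hBA : e'.toLinearMap ∘ₗ f.prodMap (0 : W' →ₗ[R] W') ∘ₗ e'.symm.toLinearMap =
      B ∘ₗ A := by
    refine LinearMap.ext fun x => ?_
    simp [A, B, LinearMap.prodMap_apply]
  rw [detOneSubSMulPoly, detOneSubSMulPoly, hAB, hBA,
    LinearMap.toMatrix_comp _ (Pi.basisFun R (Fin m)),
    LinearMap.toMatrix_comp _ (Pi.basisFun R (Fin n))]
  exact det_one_sub_X_smul_map_mul_comm _ _
end
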